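/- arXiv:chao-dyn/9706009 — 9 statements merged into one kernel-verified Lean document; each statement's English description precedes it below -/
import Mathlib

section
/- Let Γ be a finite group acting linearly on a finite-dimensional real vector space V, and let f : V → V be a continuous Γ-equivariant map generating the discrete dynamical system x ↦ f(x). If A ⊆ V is an attractor for this system, then for each element γ of Γ, either γ·A = A or γ·A ∩ A = ∅. -/
open Pointwise

/-- The ω-limit set of `x` under iteration of `f`: all limit points of the forward orbit. -/
def omegaSet {V : Type*} [TopologicalSpace V] (f : V → V) (x : V) : Set V :=
  ⋂ N : ℕ, closure {y | ∃ n, N ≤ n ∧ y = f^[n] x}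

/-- `A` is an attractor of the discrete dynamical system generated by `f`:
(1) Liapunov stable, (2) there is an open neighborhood `U` with `ω(x) ⊆ A` for all `x ∈ U`,
(3) `A = ω(x)` for some `x ∈ A` (a dense orbit). -/
structure IsAttractor {V : Type*} [TopologicalSpace V] (f : V → V) (A : Set V) : Prop where
  stable : ∀ N : Set V, IsOpen N → A ⊆ N →
    ∃ N' : Set V, IsOpen N' ∧ A ⊆ N' ∧ ∀ x ∈ N', ∀ n : ℕ, f^[n] x ∈ N
  attracting : ∃ U : Set V, IsOpen U ∧ A ⊆ U ∧ ∀ x ∈ U, omegaSet f x ⊆ A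
  denseOrbit : ∃ x ∈ A, A = omegaSet f x

/-- If `A` is an attractor of a discrete dynamical system generated by a continuous
`Γ`-equivariant map `f` on a finite-dimensional real vector space, then for every `γ ∈ Γ`,
either `γ • A = A` or `γ • A ∩ A = ∅`. -/
theorem attractor_dichotomy {Γ V : Type*} [Group Γ] [Finite Γ]
    [NormedAddCommGroup V] [NormedSpace ℝ V] [FiniteDimensional ℝ V]
    [DistribMulAction Γ V] [SMulCommClass Γ ℝ V]
    (f : V → V) (hf : Continuous f)
    (hequiv : ∀ (γ : Γ) (x : V), f (γ • x) = γ • f x)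
    (A : Set V) (hA : IsAttractor f A) :
    ∀ γ : Γ, γ • A = A ∨ (γ • A) ∩ A = ∅ := by
  intro γ
  have hcont : ∀ g : Γ, Continuous (fun v : V => g • v) := fun g =>
    (DistribSMul.toLinearMap ℝ V g).continuous_of_finiteDimensional
  have hit : ∀ (g : Γ) (n : ℕ) (v : V), f^[n] (g • v) = g • f^[n] v := by
    intro g n
    induction n with
    | zero => intro v; rfl
    | succ k ih => intro v; rw [Function.iterate_succ_apply, hequiv, ih,
        Function.iterate_succ_apply]
  by_cases hne : (γ • A) ∩ A = ∅
  · exact Or.inr hne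
  left
  obtain ⟨y, hy1, hyA⟩ := Set.nonempty_iff_ne_empty.mpr hne
  obtain ⟨a, ha, rfl⟩ := hy1
  obtain ⟨U, hUo, hAU, hU⟩ := hA.attracting
  obtain ⟨x, hx, hAx⟩ := hA.denseOrbit
  have ha' : a ∈ omegaSet f x := hAx ▸ ha
  have hcl := Set.mem_iInter.mp ha' 0
  obtain ⟨w, hwU, n, -, rfl⟩ := mem_closure_iff.mp hcl _ (hUo.preimage (hcont γ)) (hAU hyA)
  have hsub : ∀ b ∈ A, γ • b ∈ A := by
    intro b hb
    apply hU _ hwU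
    refine Set.mem_iInter.mpr fun N => ?_
    have hb' : b ∈ omegaSet f x := hAx ▸ hb
    refine map_mem_closure (hcont γ) (Set.mem_iInter.mp hb' (N + n)) ?_
    rintro _ ⟨m, hm, rfl⟩
    refine ⟨m - n, by omega, ?_⟩
    change γ • f^[m] x = f^[m - n] (γ • f^[n] x)
    rw [hit, ← Function.iterate_add_apply, Nat.sub_add_cancel (by omega)]
  have hpow : ∀ k : ℕ, ∀ b ∈ A, γ ^ k • b ∈ A := by
    intro k
    induction k with
    | zero => intro b hb; simpa using hb
    | succ k ih => intro b hb; rw [pow_succ, mul_smul]; exact ih _ (hsub b hb)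
  apply Set.Subset.antisymm
  · rintro _ ⟨b, hb, rfl⟩
    exact hsub b hb
  · intro b hb
    refine ⟨γ ^ (orderOf γ - 1) • b, hpow _ b hb, ?_⟩
    change γ • γ ^ (orderOf γ - 1) • b = b
    rw [← mul_smul, ← pow_succ', Nat.sub_add_cancel (orderOf_pos γ), pow_orderOf_eq_one, one_smul]
end

section
/- Let Γ be a finite group acting linearly on a finite-dimensional real vector space V. For every subset A ⊆ V, the instantaneous symmetry T(A) = {γ ∈ Γ : γ·x = x for all x ∈ A} is an isotropy subgroup for the action of Γ on V. -/
/-- The instantaneous (pointwise) symmetry `T(A)` of a set `A`: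
the subgroup of elements fixing every point of `A`. -/
def instSym (Γ : Type*) [Group Γ] {V : Type*} [MulAction Γ V] (A : Set V) : Subgroup Γ :=
  ⨅ x ∈ A, MulAction.stabilizer Γ x

/-- For a finite group `Γ` acting linearly on a finite-dimensional real vector space `V`,
the instantaneous symmetry `T(A)` of any subset `A ⊆ V` is an isotropy subgroup:
`T(A) = Σ(x)` for some point `x ∈ V`. -/
theorem instSym_isIsotropySubgroup {Γ V : Type*} [Group Γ] [Finite Γ]
    [AddCommGroup V] [Module ℝ V] [FiniteDimensional ℝ V]
    [DistribMulAction Γ V] [SMulCommClass Γ ℝ V]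
    (A : Set V) :
    ∃ x : V, instSym Γ A = MulAction.stabilizer Γ x := by
  classical
  have hmem : ∀ γ : Γ, γ ∈ instSym Γ A ↔ ∀ a ∈ A, γ • a = a := by
    intro γ
    simp [instSym, Subgroup.mem_iInf, MulAction.mem_stabilizer_iff]
  -- fixed subspace of `γ`
  let F : Γ → Submodule ℝ V := fun γ =>
    LinearMap.eqLocus (DistribSMul.toLinearMap ℝ V γ) LinearMap.id
  have hF : ∀ (γ : Γ) (v : V), v ∈ F γ ↔ γ • v = v := fun γ v => Iff.rfl
  let W : Submodule ℝ V := Submodule.span ℝ A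
  have hW : ∀ γ : Γ, γ ∈ instSym Γ A ↔ W ≤ F γ := by
    intro γ
    rw [hmem, Submodule.span_le]
    rfl
  let p : {γ : Γ // γ ∉ instSym Γ A} → Submodule ℝ W := fun γ => (F γ.1).comap W.subtype
  have hp : ⋃ i, (p i : Set W) ≠ Set.univ := by
    intro hcov
    obtain ⟨γ, hγ⟩ := Subspace.exists_eq_top_of_iUnion_eq_univ hcov
    refine γ.2 ((hW γ.1).2 fun w hw => ?_)
    have h : (⟨w, hw⟩ : W) ∈ p γ := hγ ▸ Submodule.mem_top
    exact h
  obtain ⟨w, hw⟩ := (Set.ne_univ_iff_exists_notMem _).1 hp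
  refine ⟨w.1, le_antisymm (fun γ hγ => ?_) (fun γ hγ => ?_)⟩
  · exact (hW γ).1 hγ w.2
  · by_contra hn
    exact hw (Set.mem_iUnion.2 ⟨⟨γ, hn⟩, hγ⟩)
end

section
/- Let Γ be a finite group acting linearly on a finite-dimensional real vector space V, and let H, G ≤ Γ both be isotropy subgroups for V. Then H ∩ G is an isotropy subgroup for V. -/
/-- The intersection of two isotropy subgroups (for a finite group acting linearly on a
finite-dimensional real vector space) is an isotropy subgroup. -/
theorem isotropy_inter_isotropy {Γ V : Type*} [Group Γ] [Finite Γ]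
    [AddCommGroup V] [Module ℝ V] [FiniteDimensional ℝ V]
    [DistribMulAction Γ V] [SMulCommClass Γ ℝ V]
    (H G : Subgroup Γ)
    (hH : ∃ x : V, H = MulAction.stabilizer Γ x)
    (hG : ∃ x : V, G = MulAction.stabilizer Γ x) :
    ∃ x : V, H ⊓ G = MulAction.stabilizer Γ x := by
  obtain ⟨x, rfl⟩ := hH
  obtain ⟨y, rfl⟩ := hG
  by_contra hcon
  have key : ∀ t : ℝ, ∃ γ : Γ, γ • (x + t • y) = x + t • y ∧ ¬ (γ • x = x ∧ γ • y = y) := by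
    intro t
    by_contra hn
    refine hcon ⟨x + t • y, le_antisymm ?_ ?_⟩
    · rintro γ ⟨h1, h2⟩
      have h1' : γ • x = x := h1
      have h2' : γ • y = y := h2
      rw [MulAction.mem_stabilizer_iff, smul_add, smul_comm γ t y, h1', h2']
    · intro γ hγ
      by_contra h
      exact hn ⟨γ, hγ, fun h' => h ⟨h'.1, h'.2⟩⟩
  choose f hf hf' using key
  obtain ⟨t, s, hts, hfe⟩ := Finite.exists_ne_map_eq_of_infinite f
  have e1 := hf t
  have e2 := hf s
  rw [← hfe] at e2
  rw [smul_add, smul_comm] at e1 e2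
  have e3 : (t - s) • (f t • y - y) = 0 := by
    have h : (t - s) • (f t • y - y)
        = (f t • x + t • f t • y - (x + t • y)) - (f t • x + s • f t • y - (x + s • y)) := by
      generalize f t • x = a
      generalize f t • y = b
      module
    rw [h, e1, e2]
    simp
  have hy : f t • y = y := by
    rcases smul_eq_zero.mp e3 with h | h
    · exact absurd (sub_eq_zero.mp h) hts
    · exact sub_eq_zero.mp h
  rw [hy] at e1
  exact hf' t ⟨add_right_cancel e1, hy⟩
end

section
/- Let Γ be a finite group with finite-dimensional real representation spaces V₁ and V₂. Suppose that for all subgroups H ≤ G ≤ Γ one has Fix_{V₁}(G) = Fix_{V₁}(H) if and only if Fix_{V₂}(G) = Fix_{V₂}(H). Then V₁ and V₂ are isotropy equivalent. -/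
/-- The fixed point subspace `Fix_V(H)` of a subgroup `H`. -/
def fixSet {Γ : Type*} [Group Γ] (V : Type*) [MulAction Γ V] (H : Subgroup Γ) : Set V :=
  {x : V | ∀ h ∈ H, h • x = x}

theorem isotropy_iff_fix {Γ V : Type*} [Group Γ] [Finite Γ]
    [AddCommGroup V] [Module ℝ V] [DistribMulAction Γ V] [SMulCommClass Γ ℝ V]
    (H : Subgroup Γ) :
    (∃ x : V, H = MulAction.stabilizer Γ x) ↔
      ∀ G : Subgroup Γ, H ≤ G → fixSet V G = fixSet V H → G = H := by
  constructor
  · rintro ⟨x, hx⟩ G hG hfix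
    refine le_antisymm (fun g hg => ?_) hG
    have hxH : x ∈ fixSet V H := by
      intro h hh
      rw [hx] at hh
      exact hh
    rw [← hfix] at hxH
    rw [hx]
    exact hxH g hg
  · intro hmax
    by_contra hne
    let F : Subgroup Γ → Submodule ℝ V := fun G =>
      { carrier := fixSet V G
        add_mem' := fun {a b} ha hb g hg => by rw [smul_add, ha g hg, hb g hg]
        zero_mem' := fun g _ => smul_zero g
        smul_mem' := fun c x hx g hg => by rw [smul_comm, hx g hg] }
    let p : {G : Subgroup Γ // H ≤ G ∧ G ≠ H} → Subspace ℝ (F H) := fun G =>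
      (F G.1).comap (F H).subtype
    have hcov : ⋃ i, (p i : Set (F H)) = Set.univ := by
      refine Set.eq_univ_of_forall fun x => Set.mem_iUnion.2 ?_
      refine ⟨⟨MulAction.stabilizer Γ (x : V), fun g hg => x.2 g hg,
        fun h => hne ⟨x, h.symm⟩⟩, ?_⟩
      exact fun g hg => hg
    obtain ⟨⟨G, hG, hGH⟩, htop⟩ := Subspace.exists_eq_top_of_iUnion_eq_univ hcov
    refine hGH (hmax G hG (Set.Subset.antisymm (fun x hx g hg => hx g (hG hg)) fun x hx => ?_))
    have : (⟨x, hx⟩ : F H) ∈ p ⟨G, hG, hGH⟩ := by rw [htop]; trivial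
    exact this

/-- Suppose that for all subgroups `H ≤ G` of `Γ`, `Fix_{V₁}(G) = Fix_{V₁}(H)` iff
`Fix_{V₂}(G) = Fix_{V₂}(H)`.  Then `V₁` and `V₂` are isotropy equivalent: a subgroup is an
isotropy subgroup for `V₁` iff it is one for `V₂`. -/
theorem isotropy_equivalent_of_fix_criterion {Γ V₁ V₂ : Type*} [Group Γ] [Finite Γ]
    [AddCommGroup V₁] [Module ℝ V₁] [FiniteDimensional ℝ V₁]
    [AddCommGroup V₂] [Module ℝ V₂] [FiniteDimensional ℝ V₂]
    [DistribMulAction Γ V₁] [SMulCommClass Γ ℝ V₁]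
    [DistribMulAction Γ V₂] [SMulCommClass Γ ℝ V₂]
    (hyp : ∀ H G : Subgroup Γ, H ≤ G →
      (fixSet V₁ G = fixSet V₁ H ↔ fixSet V₂ G = fixSet V₂ H)) :
    ∀ H : Subgroup Γ,
      (∃ x : V₁, H = MulAction.stabilizer Γ x) ↔ (∃ x : V₂, H = MulAction.stabilizer Γ x) := by
  intro H
  rw [isotropy_iff_fix, isotropy_iff_fix]
  exact forall_congr' fun G => forall_congr' fun hG => by rw [hyp H G hG]
end

section
/- Let Γ be a finite group with finite-dimensional real representation spaces V′, V₁, and V₂. If V₁ and V₂ are isotropy equivalent, then the direct sum V′ ⊕ V₁ ⊕ V₂ (with the componentwise Γ-action) is isotropy equivalent to V′ ⊕ V₁. -/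
/-- In a real representation of a finite group, the intersection of the isotropy subgroups of
two points is the isotropy subgroup of a suitable point `a + t • b`. -/
theorem exists_stabilizer_eq_inf {Γ V : Type*} [Group Γ] [Finite Γ]
    [AddCommGroup V] [Module ℝ V] [DistribMulAction Γ V] [SMulCommClass Γ ℝ V] (a b : V) :
    ∃ u : V, MulAction.stabilizer Γ u =
      MulAction.stabilizer Γ a ⊓ MulAction.stabilizer Γ b := by
  have hfin : (⋃ g : Γ, {t : ℝ | g • (a + t • b) = a + t • b ∧ ¬ (g • a = a ∧ g • b = b)}).Finite := by
    refine Set.finite_iUnion fun g => Set.Subsingleton.finite ?_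
    rintro t ⟨ht, hg⟩ s ⟨hs, -⟩
    by_contra hne
    apply hg
    rw [smul_add, smul_comm g] at ht hs
    have hb : g • b = b := by
      have h : (t - s) • (g • b - b) = 0 := by
        have : (t - s) • (g • b - b) =
          (g • a + t • g • b - (a + t • b)) - (g • a + s • g • b - (a + s • b)) := by
          generalize g • b = x; generalize g • a = y; module
        rw [this, ht, hs]; simp
      rcases smul_eq_zero.mp h with h | h
      · exact absurd (sub_eq_zero.mp h) hne
      · exact sub_eq_zero.mp h
    rw [hb] at ht
    exact ⟨add_right_cancel ht, hb⟩
  obtain ⟨t, ht⟩ := hfin.exists_notMem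
  refine ⟨a + t • b, ?_⟩
  ext g
  simp only [Subgroup.mem_inf, MulAction.mem_stabilizer_iff]
  constructor
  · intro h
    by_contra hg
    exact ht (Set.mem_iUnion.mpr ⟨g, h, hg⟩)
  · rintro ⟨h1, h2⟩
    rw [smul_add, smul_comm g, h1, h2]

theorem stabilizer_pair_eq_inf {Γ V W : Type*} [Group Γ] [MulAction Γ V] [MulAction Γ W]
    (p : V × W) : MulAction.stabilizer Γ p =
      MulAction.stabilizer Γ p.1 ⊓ MulAction.stabilizer Γ p.2 := by
  ext g
  simp [MulAction.mem_stabilizer_iff, Prod.ext_iff]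

/-- If `V₁` and `V₂` are isotropy equivalent representations of the finite group `Γ`, then
`V' ⊕ V₁ ⊕ V₂` (with the componentwise action) is isotropy equivalent to `V' ⊕ V₁`. -/
theorem isotropy_equivalent_redundant_summand {Γ V' V₁ V₂ : Type*} [Group Γ] [Finite Γ]
    [AddCommGroup V'] [Module ℝ V'] [FiniteDimensional ℝ V']
    [AddCommGroup V₁] [Module ℝ V₁] [FiniteDimensional ℝ V₁]
    [AddCommGroup V₂] [Module ℝ V₂] [FiniteDimensional ℝ V₂]
    [DistribMulAction Γ V'] [SMulCommClass Γ ℝ V']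
    [DistribMulAction Γ V₁] [SMulCommClass Γ ℝ V₁]
    [DistribMulAction Γ V₂] [SMulCommClass Γ ℝ V₂]
    (hequiv : ∀ H : Subgroup Γ,
      (∃ v : V₁, H = MulAction.stabilizer Γ v) ↔ (∃ v : V₂, H = MulAction.stabilizer Γ v)) :
    ∀ H : Subgroup Γ,
      (∃ p : V' × V₁ × V₂, H = MulAction.stabilizer Γ p) ↔
        (∃ p : V' × V₁, H = MulAction.stabilizer Γ p) := by
  intro H
  constructor
  · rintro ⟨⟨v, a, c⟩, rfl⟩
    obtain ⟨b, hb⟩ := (hequiv _).mpr ⟨c, rfl⟩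
    obtain ⟨u, hu⟩ := exists_stabilizer_eq_inf (Γ := Γ) a b
    refine ⟨(v, u), ?_⟩
    simp only [stabilizer_pair_eq_inf, hu, hb]
  · rintro ⟨⟨v, a⟩, rfl⟩
    obtain ⟨c, hc⟩ := (hequiv _).mp ⟨a, rfl⟩
    refine ⟨(v, a, c), ?_⟩
    simp only [stabilizer_pair_eq_inf, ← hc, inf_idem]
end

section
/- Let M and V be finite-dimensional real representation spaces of a finite group Γ, and let φ be a Γ-equivariant linear map from M onto V. Suppose A ∈ 𝒜(M) satisfies: (1) T(A) is an isotropy subgroup for the action of Γ on V, and (2) there exists a ∈ A with Σ(a) = T(A). Then for each positive integer k there exists a set 𝒪 ⊆ C^k_Γ(M), open and dense with respect to the topology induced by the C^k distance ‖ψ₁ − ψ₂‖_{C^k}, such that for all ψ ∈ 𝒪: Σ(φ(ψ(a))) = Σ(a), T(φ(ψ(A))) = T(A), and Σ(φ(ψ(A))) = Σ(A). -/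
open Pointwise
open scoped ENNReal

/-- The (extended) `C^k` distance between two maps: the supremum over `0 ≤ j ≤ k` and
`x ∈ M` of the operator norms of the `j`-th derivatives of `f - g` at `x`. -/
noncomputable def ckDist {M : Type*} [NormedAddCommGroup M] [NormedSpace ℝ M]
    (k : ℕ) (f g : M → M) : ℝ≥0∞ :=
  ⨆ (j : Fin (k + 1)) (x : M), (‖iteratedFDeriv ℝ (j : ℕ) (f - g) x‖₊ : ℝ≥0∞)

/-- The set `C^k_Γ(M)` of `k`-times continuously differentiable `Γ`-equivariant maps. -/
def CkEquivariant (Γ : Type*) [Group Γ] (M : Type*) [NormedAddCommGroup M]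
    [NormedSpace ℝ M] [MulAction Γ M] (k : ℕ) : Set (M → M) :=
  {ψ : M → M | ContDiff ℝ k ψ ∧ ∀ (γ : Γ) (x : M), ψ (γ • x) = γ • ψ x}

lemma aux_cut {M : Type*} [NormedAddCommGroup M] [NormedSpace ℝ M] [FiniteDimensional ℝ M]
    (s t : Set M) (hs : s.Finite) (ht : t.Finite) (hd : Disjoint s t) :
    ∃ f : M → ℝ, ContDiff ℝ (⊤ : ℕ∞) f ∧ HasCompactSupport f ∧ (∀ x, 0 ≤ f x) ∧ (∀ x, f x ≤ 1) ∧
      (∀ x ∈ s, f x = 0) ∧ ∀ x, f x = 1 ↔ x ∈ t := by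
  obtain ⟨R, hR⟩ := ht.isBounded.subset_ball (0 : M)
  have hcl : IsClosed (s ∪ (Metric.ball (0 : M) R)ᶜ) :=
    hs.isClosed.union Metric.isOpen_ball.isClosed_compl
  have hdis : Disjoint (s ∪ (Metric.ball (0 : M) R)ᶜ) t := by
    rw [Set.disjoint_union_left]
    exact ⟨hd, Set.disjoint_compl_left_iff_subset.2 hR⟩
  obtain ⟨f, hf, hr, h0, h1⟩ := exists_contMDiff_zero_iff_one_iff_of_isClosed (n := (⊤ : ℕ∞))
    (modelWithCornersSelf ℝ M) hcl ht.isClosed hdis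
  refine ⟨f, hf.contDiff, ?_, fun x => (hr ⟨x, rfl⟩).1, fun x => (hr ⟨x, rfl⟩).2,
    fun x hx => (h0 x).1 (Or.inl hx), fun x => (h1 x).symm⟩
  refine HasCompactSupport.intro (isCompact_closedBall (0 : M) R) fun x hx => (h0 x).1 (Or.inr ?_)
  intro hx'
  exact hx (Metric.ball_subset_closedBall hx')

lemma aux_smul_cont {Γ M : Type*} [Group Γ] [NormedAddCommGroup M] [NormedSpace ℝ M]
    [FiniteDimensional ℝ M] [DistribMulAction Γ M] [SMulCommClass Γ ℝ M] (n : WithTop ℕ∞) (γ : Γ) :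
    ContDiff ℝ n (fun x : M => γ • x) :=
  (LinearMap.toContinuousLinearMap (DistribSMul.toLinearMap ℝ M γ)).contDiff

lemma aux_smul_cs {Γ M : Type*} {E : Type*} [Zero E] [Group Γ] [NormedAddCommGroup M] [NormedSpace ℝ M]
    [FiniteDimensional ℝ M] [DistribMulAction Γ M] [SMulCommClass Γ ℝ M] (γ : Γ)
    (f : M → E) (hf : HasCompactSupport f) : HasCompactSupport (fun x : M => f (γ • x)) := by
  refine HasCompactSupport.intro (K := (fun x : M => γ⁻¹ • x) '' tsupport f) ?_ ?_
  · exact IsCompact.image hf (aux_smul_cont (Γ := Γ) 0 γ⁻¹).continuous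
  · intro x hx
    by_contra h
    exact hx ⟨γ • x, subset_tsupport f h, by simp⟩

lemma aux_small {M : Type*} [NormedAddCommGroup M] [NormedSpace ℝ M]
    (k : ℕ) (p : M → M) (hp : ContDiff ℝ k p) (hc : HasCompactSupport p) (ε : ℝ≥0∞) (hε : 0 < ε) :
    ∃ s0 : ℝ, 0 < s0 ∧ ∀ s : ℝ, 0 < s → s < s0 → ∀ ψ : M → M, ckDist k (ψ + s • p) ψ < ε := by
  have hb : ∀ j : Fin (k+1), ∃ C : ℝ, ∀ x, ‖iteratedFDeriv ℝ (j:ℕ) p x‖ ≤ C := by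
    intro j
    have hj : ((j:ℕ) : WithTop ℕ∞) ≤ k := by exact_mod_cast Nat.lt_succ_iff.1 j.2
    exact (hc.iteratedFDeriv (𝕜 := ℝ) (j:ℕ)).exists_bound_of_continuous (hp.continuous_iteratedFDeriv hj)
  choose C hC using hb
  set D : ℝ := ∑ j, |C j| + 1 with hD
  have hD0 : 0 < D := by positivity
  have hCD : ∀ j, C j ≤ D := fun j => by
    have := Finset.single_le_sum (f := fun j => |C j|) (fun i _ => abs_nonneg _) (Finset.mem_univ j)
    have := le_abs_self (C j)
    linarith
  obtain ⟨r, hr0, hrε⟩ : ∃ r : ℝ, 0 < r ∧ ENNReal.ofReal r < ε := by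
    obtain ⟨q, h1, h2⟩ := ENNReal.lt_iff_exists_nnreal_btwn.1 hε
    exact ⟨q, by exact_mod_cast h1, by simpa using h2⟩
  refine ⟨r / D, by positivity, fun s hs hs' ψ => lt_of_le_of_lt ?_ hrε⟩
  have hsD : s * D ≤ r := by
    rw [lt_div_iff₀ hD0] at hs'; exact hs'.le
  unfold ckDist
  refine iSup_le fun j => iSup_le fun x => ?_
  have hj : ((j:ℕ) : WithTop ℕ∞) ≤ k := by exact_mod_cast Nat.lt_succ_iff.1 j.2
  rw [add_sub_cancel_left, iteratedFDeriv_const_smul_apply (hp.of_le hj).contDiffAt]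
  rw [← enorm_eq_nnnorm, ← ofReal_norm]
  apply ENNReal.ofReal_le_ofReal
  rw [norm_smul, Real.norm_of_nonneg hs.le]
  exact (mul_le_mul_of_nonneg_left ((hC j x).trans (hCD j)) hs.le).trans hsD

lemma aux_ck_le {M : Type*} [NormedAddCommGroup M] [NormedSpace ℝ M]
    (k : ℕ) (f g : M → M) (x : M) : ENNReal.ofReal ‖f x - g x‖ ≤ ckDist k f g := by
  unfold ckDist
  refine le_trans (le_of_eq ?_) (le_iSup_of_le (0 : Fin (k+1)) (le_iSup_of_le x le_rfl))
  rw [← enorm_eq_nnnorm, ← ofReal_norm]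
  rw [show (((0 : Fin (k+1)) : ℕ)) = 0 from rfl, norm_iteratedFDeriv_zero]
  rfl

lemma aux_ck_tri {M : Type*} [NormedAddCommGroup M] [NormedSpace ℝ M]
    (k : ℕ) (f g h : M → M) (hf : ContDiff ℝ k f) (hg : ContDiff ℝ k g) (hh : ContDiff ℝ k h) :
    ckDist k f h ≤ ckDist k f g + ckDist k g h := by
  conv_lhs => unfold ckDist
  refine iSup_le fun j => iSup_le fun x => ?_
  have hj : ((j:ℕ) : WithTop ℕ∞) ≤ k := by exact_mod_cast Nat.lt_succ_iff.1 j.2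
  have e : f - h = (f - g) + (g - h) := by abel
  have c1 : ContDiff ℝ (j:ℕ) (f - g) := (hf.sub hg).of_le hj
  have c2 : ContDiff ℝ (j:ℕ) (g - h) := (hg.sub hh).of_le hj
  rw [e, iteratedFDeriv_add_apply c1.contDiffAt c2.contDiffAt]
  refine le_trans (ENNReal.coe_le_coe.2 (nnnorm_add_le _ _)) ?_
  rw [ENNReal.coe_add]
  refine add_le_add ?_ ?_
  · exact le_iSup_of_le (f := fun j : Fin (k+1) => ⨆ x, (‖iteratedFDeriv ℝ (j : ℕ) (f - g) x‖₊ : ℝ≥0∞)) j (le_iSup_of_le x le_rfl)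
  · exact le_iSup_of_le (f := fun j : Fin (k+1) => ⨆ x, (‖iteratedFDeriv ℝ (j : ℕ) (g - h) x‖₊ : ℝ≥0∞)) j (le_iSup_of_le x le_rfl)

lemma aux_open {M V : Type*} [NormedAddCommGroup M] [NormedSpace ℝ M] [FiniteDimensional ℝ M]
    [NormedAddCommGroup V] [NormedSpace ℝ V] (φ : M →ₗ[ℝ] V) (k : ℕ) (ψ : M → M)
    (hψ : Continuous ψ) (z : M) (C : Set M) (hC : IsCompact C) (hz : ∀ y ∈ C, φ (ψ z) ≠ φ (ψ y)) :
    ∃ ε : ℝ≥0∞, 0 < ε ∧ ∀ ψ' : M → M, ckDist k ψ' ψ < ε → ∀ y ∈ C, φ (ψ' z) ≠ φ (ψ' y) := by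
  set L := LinearMap.toContinuousLinearMap φ with hL
  have hLφ : ∀ x, L x = φ x := fun x => rfl
  rcases C.eq_empty_or_nonempty with rfl | hne
  · exact ⟨1, one_pos, by simp⟩
  obtain ⟨y0, hy0, hmin⟩ := hC.exists_isMinOn hne
    (f := fun y => ‖L (ψ z) - L (ψ y)‖) (by fun_prop)
  set δ := ‖L (ψ z) - L (ψ y0)‖ with hδ
  have hδ0 : 0 < δ := norm_pos_iff.2 (sub_ne_zero.2 (hz y0 hy0))
  set r : ℝ := δ / (4 * (‖L‖ + 1)) with hr
  have hL1 : 0 < ‖L‖ + 1 := by positivity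
  have hr0 : 0 < r := by positivity
  refine ⟨ENNReal.ofReal r, by simpa using hr0, fun ψ' hd y hy heq => ?_⟩
  have hb : ∀ x, ‖L (ψ' x) - L (ψ x)‖ ≤ δ / 4 := fun x => by
    have h1 := (aux_ck_le k ψ' ψ x).trans_lt hd
    have h2 : ‖ψ' x - ψ x‖ < r := (ENNReal.ofReal_lt_ofReal_iff hr0).1 h1
    rw [← map_sub]
    calc ‖L (ψ' x - ψ x)‖ ≤ ‖L‖ * ‖ψ' x - ψ x‖ := L.le_opNorm _
      _ ≤ (‖L‖ + 1) * r := by gcongr; linarith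
      _ = δ / 4 := by rw [hr]; field_simp
  have h3 : δ ≤ ‖L (ψ z) - L (ψ y)‖ := hmin hy
  have h4 : L (ψ z) - L (ψ y) = -(L (ψ' z) - L (ψ z)) + (L (ψ' y) - L (ψ y)) := by
    have : L (ψ' z) = L (ψ' y) := heq
    rw [this]; abel
  rw [h4] at h3
  have h5 := norm_add_le (-(L (ψ' z) - L (ψ z))) (L (ψ' y) - L (ψ y))
  rw [norm_neg] at h5
  linarith [hb z, hb y]

lemma aux_sub {Γ X : Type*} [Group Γ] [Finite Γ] [MulAction Γ X] (γ : Γ) (B : Set X)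
    (h : ∀ b ∈ B, γ • b ∈ B) : γ • B = B := by
  have hp : ∀ n : ℕ, ∀ b ∈ B, γ ^ n • b ∈ B := by
    intro n
    induction n with
    | zero => simp
    | succ n ih => intro b hb; rw [pow_succ, mul_smul]; exact ih _ (h b hb)
  have hi : ∀ b ∈ B, γ⁻¹ • b ∈ B := by
    intro b hb
    have : γ⁻¹ ∈ Submonoid.powers γ := by
      rw [mem_powers_iff_mem_zpowers]; exact (Subgroup.inv_mem _ (Subgroup.mem_zpowers γ))
    obtain ⟨n, hn⟩ := this
    have hn : γ ^ n = γ⁻¹ := hn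
    rw [← hn]; exact hp n b hb
  ext x
  rw [Set.mem_smul_set_iff_inv_smul_mem]
  exact ⟨fun hx => by simpa using h _ hx, fun hx => hi x hx⟩

lemma aux_F {Γ V : Type*} [Group Γ] [Finite Γ] [NormedAddCommGroup V] [NormedSpace ℝ V]
    [FiniteDimensional ℝ V] [DistribMulAction Γ V] [SMulCommClass Γ ℝ V] (T : Subgroup Γ) :
    ∃ (F : V → ℝ) (d : ℕ), Continuous F ∧ (∀ w, 0 ≤ F w) ∧
      (∀ w, F w ≠ 0 ↔ ∀ g : Γ, g ∉ T → g • w ≠ w) ∧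
      (∀ c : ℝ, 0 ≤ c → ∀ w, F (c • w) = c ^ d * F w) ∧
      (∀ γ : Γ, (∀ g : Γ, g ∈ T ↔ γ * g * γ⁻¹ ∈ T) → ∀ w, F (γ • w) = F w) ∧
      ((∃ g : Γ, g ∉ T) → d ≠ 0) := by
  classical
  have := Fintype.ofFinite Γ
  set N : V → ℝ := fun w => ∑ g : Γ, ‖g • w‖ with hN
  have hN0 : ∀ w, 0 ≤ N w := fun w => Finset.sum_nonneg fun _ _ => norm_nonneg _
  have hNz : ∀ w, N w = 0 ↔ w = 0 := by
    intro w
    constructor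
    · intro h
      have := (Finset.sum_eq_zero_iff_of_nonneg (fun (g : Γ) _ => norm_nonneg (g • w))).1 h 1 (Finset.mem_univ _)
      simpa using this
    · rintro rfl; simp [hN]
  have hNi : ∀ (γ : Γ) w, N (γ • w) = N w := by
    intro γ w
    simp only [hN, smul_smul]
    exact Fintype.sum_equiv (Equiv.mulRight γ) _ _ (fun g => by simp)
  have hNc : ∀ (c : ℝ), 0 ≤ c → ∀ w, N (c • w) = c * N w := by
    intro c hc w
    simp only [hN, Finset.mul_sum]
    refine Finset.sum_congr rfl fun g _ => ?_
    rw [smul_comm, norm_smul, Real.norm_of_nonneg hc]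
  have hcs : ∀ g : Γ, Continuous fun w : V => g • w := fun g => (aux_smul_cont 0 g).continuous
  have hNcont : Continuous N := continuous_finsetSum _ fun g _ => (hcs g).norm
  set S := Finset.univ.filter (fun g : Γ => g ∉ T) with hS
  refine ⟨fun w => ∏ g ∈ S, N (g • w - w), S.card, ?_, ?_, ?_, ?_, ?_, ?_⟩
  · exact continuous_finsetProd _ fun g _ => hNcont.comp ((hcs g).sub continuous_id)
  · exact fun w => Finset.prod_nonneg fun _ _ => hN0 _
  · intro w
    rw [Finset.prod_ne_zero_iff]
    simp [hS, hNz, sub_eq_zero]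
  · intro c hc w
    rw [← Finset.prod_const, ← Finset.prod_mul_distrib]
    refine Finset.prod_congr rfl fun g _ => ?_
    rw [smul_comm, ← smul_sub, hNc c hc]
  · intro γ hγ w
    symm
    refine Finset.prod_equiv (MulAut.conj γ).toEquiv ?_ ?_
    · intro g; simp [hS, hγ g]
    · intro g _
      rw [← hNi γ]
      simp [smul_sub, mul_smul]
  · rintro ⟨g, hg⟩
    exact Finset.card_ne_zero.2 ⟨g, by simp [hS, hg]⟩

lemma aux_mem_inst {Γ V : Type*} [Group Γ] [MulAction Γ V] (A : Set V) (g : Γ) :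
    g ∈ instSym Γ A ↔ ∀ x ∈ A, g • x = x := by
  simp [instSym, Subgroup.mem_iInf, MulAction.mem_stabilizer_iff]

/-- First perturbation direction. -/
lemma aux_p {Γ M : Type*} [Group Γ] [Finite Γ]
    [NormedAddCommGroup M] [NormedSpace ℝ M] [FiniteDimensional ℝ M]
    [DistribMulAction Γ M] [SMulCommClass Γ ℝ M] (a u : M) :
    ∃ p : M → M, ContDiff ℝ (⊤ : ℕ∞) p ∧ HasCompactSupport p ∧
      (∀ (γ : Γ) x, p (γ • x) = γ • p x) ∧
      ∀ {V : Type*} [AddCommGroup V] [Module ℝ V] [DistribMulAction Γ V] (φ : M →ₗ[ℝ] V),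
        (∀ (γ : Γ) x, φ (γ • x) = γ • φ x) → (∀ g : Γ, g • a = a → g • φ u = φ u) →
        ∃ c : ℝ, 0 < c ∧ φ (p a) = c • φ u := by
  classical
  have := Fintype.ofFinite Γ
  obtain ⟨b, hb, hbc, hb0, -, hbs, hb1⟩ := aux_cut (M := M)
    (Set.range (fun g : Γ => g • a) \ {a}) {a} ((Set.finite_range _).subset Set.sdiff_subset)
    (Set.finite_singleton a) Set.disjoint_sdiff_left
  refine ⟨fun x => ∑ g : Γ, b (g⁻¹ • x) • (g • u), ?_, ?_, ?_, ?_⟩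
  · exact ContDiff.sum fun g _ => (hb.comp (aux_smul_cont _ g⁻¹)).smul contDiff_const
  · have : ∀ s : Finset Γ, HasCompactSupport (fun x : M => ∑ g ∈ s, b (g⁻¹ • x) • (g • u)) := by
      intro s
      induction s using Finset.induction_on with
      | empty => simp only [Finset.sum_empty]; exact HasCompactSupport.zero
      | insert g s hg ih =>
        simp only [Finset.sum_insert hg]
        exact HasCompactSupport.add (HasCompactSupport.smul_right (aux_smul_cs g⁻¹ b hbc)) ih
    exact this _
  · intro γ x
    simp only [Finset.smul_sum]
    symm
    refine Fintype.sum_equiv (Equiv.mulLeft γ) _ _ fun g => ?_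
    simp [mul_smul, smul_comm γ (b (g⁻¹ • x))]
  · intro V _ _ _ φ hφ hu
    refine ⟨∑ g : Γ, b (g⁻¹ • a), ?_, ?_⟩
    · refine Finset.sum_pos' (fun g _ => hb0 _) ⟨1, Finset.mem_univ _, ?_⟩
      have : b a = 1 := (hb1 a).2 rfl
      simp [this]
    · simp only [map_sum, map_smul, Finset.sum_smul]
      refine Finset.sum_congr rfl fun g _ => ?_
      by_cases h : g⁻¹ • a = a
      · have : g • a = a := by rw [inv_smul_eq_iff] at h; exact h.symm
        rw [hφ, hu g this]
      · rw [hbs _ ⟨⟨g⁻¹, rfl⟩, h⟩]; simp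

/-- Invariant bump function attaining its maximum exactly on an orbit. -/
lemma aux_h {Γ M : Type*} [Group Γ] [Finite Γ]
    [NormedAddCommGroup M] [NormedSpace ℝ M] [FiniteDimensional ℝ M]
    [DistribMulAction Γ M] [SMulCommClass Γ ℝ M] (x : M) :
    ∃ h : M → ℝ, ContDiff ℝ (⊤ : ℕ∞) h ∧ HasCompactSupport h ∧
      (∀ (γ : Γ) y, h (γ • y) = h y) ∧ (∀ y, 0 ≤ h y) ∧ (∀ y, h y ≤ h x) ∧
      ∀ y, h y = h x → ∃ γ : Γ, y = γ • x := by
  classical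
  have := Fintype.ofFinite Γ
  obtain ⟨f, hf, hfc, hf0, hf1, -, hft⟩ := aux_cut (M := M)
    ∅ (Set.range (fun g : Γ => g • x)) Set.finite_empty (Set.finite_range _) (Set.empty_disjoint _)
  have hx : ∑ g : Γ, f (g • x) = ∑ g : Γ, (1 : ℝ) :=
    Finset.sum_congr rfl fun g _ => (hft _).2 ⟨g, rfl⟩
  refine ⟨fun y => ∑ g : Γ, f (g • y), ?_, ?_, ?_, ?_, ?_, ?_⟩
  · exact ContDiff.sum fun g _ => (hf.comp (aux_smul_cont _ g))
  · have : ∀ s : Finset Γ, HasCompactSupport (fun x : M => ∑ g ∈ s, f (g • x)) := by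
      intro s
      induction s using Finset.induction_on with
      | empty => simp only [Finset.sum_empty]; exact HasCompactSupport.zero
      | insert g s hg ih =>
        simp only [Finset.sum_insert hg]
        exact HasCompactSupport.add (aux_smul_cs g f hfc) ih
    exact this _
  · intro γ y
    exact Fintype.sum_equiv (Equiv.mulRight γ) _ _ fun g => by simp [mul_smul]
  · exact fun y => Finset.sum_nonneg fun g _ => hf0 _
  · intro y
    simp only [hx]
    exact Finset.sum_le_sum fun g _ => hf1 _
  · intro y hy
    simp only [hx] at hy
    have h1 := (Finset.sum_eq_sum_iff_of_le (fun g _ => hf1 _)).1 hy 1 (Finset.mem_univ _)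
    rw [one_smul] at h1
    obtain ⟨γ, hγ⟩ := (hft _).1 h1
    exact ⟨γ, hγ.symm⟩

lemma aux_min {ι : Type*} [Finite ι] (e : ι → ℝ≥0∞) (h : ∀ i, 0 < e i) :
    ∃ ε : ℝ≥0∞, 0 < ε ∧ ∀ i, ε ≤ e i := by
  rcases isEmpty_or_nonempty ι with _ | _
  · exact ⟨1, one_pos, fun i => isEmptyElim i⟩
  · obtain ⟨i, hi⟩ := Finite.exists_min e
    exact ⟨e i, h i, hi⟩

/-- **Main theorem.**  Let `φ : M → V` be an equivariant linear surjection, and let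
`A ∈ 𝒜(M)` (compact, satisfying the dichotomy) be such that `T(A)` is an isotropy subgroup
for `V` and some `a ∈ A` has `Σ(a) = T(A)`.  Then for each `k ≥ 1` there is a subset `𝒪` of
`C^k_Γ(M)`, open and dense for the `C^k` distance, such that for all `ψ ∈ 𝒪`:
`Σ(φ(ψ(a))) = Σ(a)`, `T(φ(ψ(A))) = T(A)` and `Σ(φ(ψ(A))) = Σ(A)`. -/
theorem generic_projection_preserves_symmetry {Γ M V : Type*} [Group Γ] [Finite Γ]
    [NormedAddCommGroup M] [NormedSpace ℝ M] [FiniteDimensional ℝ M]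
    [NormedAddCommGroup V] [NormedSpace ℝ V] [FiniteDimensional ℝ V]
    [DistribMulAction Γ M] [SMulCommClass Γ ℝ M]
    [DistribMulAction Γ V] [SMulCommClass Γ ℝ V]
    (φ : M →ₗ[ℝ] V) (hsurj : Function.Surjective φ)
    (hequiv : ∀ (γ : Γ) (x : M), φ (γ • x) = γ • φ x)
    (A : Set M) (hcpt : IsCompact A)
    (hdich : ∀ γ : Γ, γ • A = A ∨ (γ • A) ∩ A = ∅)
    (hTiso : ∃ v : V, instSym Γ A = MulAction.stabilizer Γ v)
    (a : M) (ha : a ∈ A) (haT : MulAction.stabilizer Γ a = instSym Γ A)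
    (k : ℕ) (hk : 0 < k) :
    ∃ O ⊆ CkEquivariant Γ M k,
      (∀ ψ ∈ O, ∃ ε : ℝ≥0∞, 0 < ε ∧
        ∀ ψ' ∈ CkEquivariant Γ M k, ckDist k ψ' ψ < ε → ψ' ∈ O) ∧
      (∀ ψ ∈ CkEquivariant Γ M k, ∀ ε : ℝ≥0∞, 0 < ε →
        ∃ ψ' ∈ O, ckDist k ψ' ψ < ε) ∧
      (∀ ψ ∈ O,
        MulAction.stabilizer Γ (φ (ψ a)) = MulAction.stabilizer Γ a ∧
        instSym Γ (φ '' (ψ '' A)) = instSym Γ A ∧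
        MulAction.stabilizer Γ (φ '' (ψ '' A)) = MulAction.stabilizer Γ A) := by
  obtain ⟨v, hv⟩ := hTiso
  have hTA : ∀ g : Γ, g ∈ instSym Γ A ↔ g • a = a := fun g => by
    rw [← haT, MulAction.mem_stabilizer_iff]
  have hTv : ∀ g : Γ, g ∈ instSym Γ A ↔ g • v = v := fun g => by
    rw [hv, MulAction.mem_stabilizer_iff]
  set T := instSym Γ A with hT
  have hTx : ∀ g ∈ T, ∀ x ∈ A, g • x = x := fun g hg => (aux_mem_inst A g).1 hg
  have hTH : ∀ g ∈ T, g • A = A := fun g hg => aux_sub g A fun b hb => by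
    rw [hTx g hg b hb]; exact hb
  have hcomp : ∀ ψ ∈ CkEquivariant Γ M k, ∀ (γ : Γ) x, φ (ψ (γ • x)) = γ • φ (ψ x) := by
    intro ψ hψ γ x
    rw [hψ.2, hequiv]
  have hstab : ∀ ψ ∈ CkEquivariant Γ M k, (∀ γ : Γ, γ ∉ T → γ • φ (ψ a) ≠ φ (ψ a)) →
      MulAction.stabilizer Γ (φ (ψ a)) = MulAction.stabilizer Γ a := by
    intro ψ hψ h
    ext g
    rw [MulAction.mem_stabilizer_iff, MulAction.mem_stabilizer_iff]
    constructor
    · intro hg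
      by_contra hc
      exact h g (fun h' => hc ((hTA g).1 h')) hg
    · intro hg
      rw [← hcomp ψ hψ, hg]
  have hinst : ∀ ψ ∈ CkEquivariant Γ M k,
      MulAction.stabilizer Γ (φ (ψ a)) = MulAction.stabilizer Γ a →
      instSym Γ (φ '' (ψ '' A)) = T := by
    intro ψ hψ h
    ext g
    rw [aux_mem_inst]
    constructor
    · intro hg
      rw [hTA, ← MulAction.mem_stabilizer_iff, ← h, MulAction.mem_stabilizer_iff]
      exact hg _ ⟨_, ⟨a, ha, rfl⟩, rfl⟩
    · rintro hg _ ⟨_, ⟨x, hx, rfl⟩, rfl⟩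
      rw [← hcomp ψ hψ, hTx g hg x hx]
  have hstabA : ∀ ψ ∈ CkEquivariant Γ M k,
      (∀ γ : Γ, γ • A ≠ A → γ • (φ '' (ψ '' A)) ≠ φ '' (ψ '' A)) →
      MulAction.stabilizer Γ (φ '' (ψ '' A)) = MulAction.stabilizer Γ A := by
    intro ψ hψ h
    ext g
    rw [MulAction.mem_stabilizer_iff, MulAction.mem_stabilizer_iff]
    constructor
    · intro hg
      by_contra hc
      exact h g hc hg
    · intro hg
      apply aux_sub
      rintro _ ⟨_, ⟨x, hx, rfl⟩, rfl⟩
      rw [← hcomp ψ hψ]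
      refine ⟨_, ⟨g • x, ?_, rfl⟩, rfl⟩
      rw [← hg]; exact Set.smul_mem_smul_set hx
  refine ⟨{ψ | ψ ∈ CkEquivariant Γ M k ∧
      (∀ γ : Γ, γ ∉ T → γ • φ (ψ a) ≠ φ (ψ a)) ∧
      (∀ γ : Γ, γ • A ≠ A → γ • (φ '' (ψ '' A)) ≠ φ '' (ψ '' A))}, fun ψ h => h.1, ?_, ?_, ?_⟩
  · rintro ψ ⟨hψ, h1, h2⟩
    have e1 : ∀ γ : Γ, ∃ ε : ℝ≥0∞, 0 < ε ∧ (γ ∉ T → ∀ ψ' : M → M, ckDist k ψ' ψ < ε →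
        φ (ψ' (γ • a)) ≠ φ (ψ' a)) := by
      intro γ
      by_cases hγ : γ ∈ T
      · exact ⟨1, one_pos, fun h => absurd hγ h⟩
      · obtain ⟨ε, hε, h⟩ := aux_open φ k ψ hψ.1.continuous (γ • a) {a} isCompact_singleton (by
          rintro _ rfl
          rw [hcomp ψ hψ]; exact h1 γ hγ)
        exact ⟨ε, hε, fun _ ψ' hd => h ψ' hd a rfl⟩
    have e2 : ∀ γ : Γ, ∃ ε : ℝ≥0∞, 0 < ε ∧ (γ • A ≠ A → ∃ x ∈ A, ∀ ψ' : M → M, ckDist k ψ' ψ < ε →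
        ∀ y ∈ A, φ (ψ' (γ • x)) ≠ φ (ψ' y)) := by
      intro γ
      by_cases hγ : γ • A = A
      · exact ⟨1, one_pos, fun h => absurd hγ h⟩
      · have : ∃ x ∈ A, ∀ y ∈ A, φ (ψ (γ • x)) ≠ φ (ψ y) := by
          by_contra! hc
          refine h2 γ hγ (aux_sub γ _ ?_)
          rintro _ ⟨_, ⟨x, hx, rfl⟩, rfl⟩
          obtain ⟨y, hy, hxy⟩ := hc x hx
          rw [← hcomp ψ hψ, hxy]
          exact ⟨_, ⟨y, hy, rfl⟩, rfl⟩
        obtain ⟨x, hx, hxy⟩ := this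
        obtain ⟨ε, hε, h⟩ := aux_open φ k ψ hψ.1.continuous (γ • x) A hcpt hxy
        exact ⟨ε, hε, fun _ => ⟨x, hx, h⟩⟩
    choose ε1 hε1 he1 using e1
    choose ε2 hε2 he2 using e2
    obtain ⟨δ1, hδ1, hd1⟩ := aux_min ε1 hε1
    obtain ⟨δ2, hδ2, hd2⟩ := aux_min ε2 hε2
    refine ⟨min δ1 δ2, lt_min hδ1 hδ2, fun ψ' hψ' hd => ⟨hψ', ?_, ?_⟩⟩
    · intro γ hγ
      rw [← hcomp ψ' hψ']
      exact he1 γ hγ ψ' (hd.trans_le ((min_le_left _ _).trans (hd1 γ)))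
    · intro γ hγ heq
      obtain ⟨x, hx, h⟩ := he2 γ hγ
      have h3 := h ψ' (hd.trans_le ((min_le_right _ _).trans (hd2 γ)))
      have : γ • φ (ψ' x) ∈ φ '' (ψ' '' A) := by
        rw [← heq]; exact Set.smul_mem_smul_set ⟨_, ⟨x, hx, rfl⟩, rfl⟩
      obtain ⟨_, ⟨y, hy, rfl⟩, hyx⟩ := this
      apply h3 y hy
      rw [hcomp ψ' hψ', hyx]
  · intro ψ hψ ε hε
    have hε2 : 0 < ε / 2 := ENNReal.half_pos hε.ne'
    have step1 : ∃ ψ1 ∈ CkEquivariant Γ M k, ckDist k ψ1 ψ < ε / 2 ∧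
        ∀ γ : Γ, γ ∉ T → γ • φ (ψ1 a) ≠ φ (ψ1 a) := by
      obtain ⟨u, hu⟩ := hsurj v
      obtain ⟨p, hp, hpc, hpe, hpa⟩ := aux_p (Γ := Γ) a u
      obtain ⟨c, hc, hpc'⟩ := hpa φ hequiv (fun g hg => by
        rw [hu]; exact (hTv g).1 ((hTA g).2 hg))
      have hpk : ContDiff ℝ k p := hp.of_le (by exact_mod_cast le_top)
      obtain ⟨s0, hs0, hs⟩ := aux_small k p hpk hpc (ε / 2) hε2
      have hbad : ∀ γ : Γ, γ ∉ T →
          {s : ℝ | γ • φ (ψ a + s • p a) = φ (ψ a + s • p a)}.Subsingleton := by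
        intro γ hγ s hs t ht
        simp only [Set.mem_ofPred_eq, map_add, map_smul, hpc', hu, smul_add,
          smul_comm γ (_ : ℝ)] at hs ht
        have hne : γ • v - v ≠ 0 := sub_ne_zero.2 fun h => hγ ((hTv γ).2 h)
        have h0 : ((s - t) * c) • (γ • v - v) = 0 := by
          have e : ((s - t) * c) • (γ • v - v) =
            ((γ • φ (ψ a) + s • c • γ • v) - (γ • φ (ψ a) + t • c • γ • v))
              - ((φ (ψ a) + s • c • v) - (φ (ψ a) + t • c • v)) := by
            generalize γ • v = v', γ • φ (ψ a) = q
            module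
          rw [e, hs, ht, sub_self]
        rcases smul_eq_zero.1 h0 with h | h
        · rcases mul_eq_zero.1 h with h | h
          · linarith
          · exact absurd h hc.ne'
        · exact absurd h hne
      have hfin : (⋃ γ : {γ : Γ // γ ∉ T},
          {s : ℝ | γ.1 • φ (ψ a + s • p a) = φ (ψ a + s • p a)}).Finite :=
        Set.finite_iUnion fun γ => (hbad γ.1 γ.2).finite
      obtain ⟨s, hsI, hsn⟩ := ((Set.Ioo_infinite hs0).sdiff hfin).nonempty
      refine ⟨ψ + s • p, ⟨hψ.1.add (contDiff_const.smul hpk), ?_⟩, hs s hsI.1 hsI.2 ψ, ?_⟩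
      · intro γ x
        simp [hψ.2 γ x, hpe γ x, smul_add, smul_comm γ s]
      · intro γ hγ h
        exact hsn (Set.mem_iUnion.2 ⟨⟨γ, hγ⟩, h⟩)
    obtain ⟨ψ1, hψ1, hd1, hfree⟩ := step1
    obtain ⟨F, d, hFc, hF0, hFne, hFs, hFi, hd⟩ := aux_F (V := V) T
    have hφc : Continuous φ := φ.continuous_of_finiteDimensional
    obtain ⟨x, hx, hmax⟩ := hcpt.exists_isMaxOn ⟨a, ha⟩ (f := fun y => F (φ (ψ1 y)))
      ((hFc.comp (hφc.comp hψ1.1.continuous)).continuousOn)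
    have hmax : ∀ y ∈ A, F (φ (ψ1 y)) ≤ F (φ (ψ1 x)) := fun y hy => hmax hy
    have hFx : 0 < F (φ (ψ1 x)) :=
      lt_of_lt_of_le (lt_of_le_of_ne (hF0 _) ((hFne _).2 hfree).symm) (hmax a ha)
    obtain ⟨h, hh, hhc, hhi, hh0, hhx, hho⟩ := aux_h (Γ := Γ) x
    have hpk : ContDiff ℝ k (fun y => h y • ψ1 y) :=
      (hh.of_le (by exact_mod_cast le_top)).smul hψ1.1
    obtain ⟨s0, hs0, hs⟩ := aux_small k (fun y => h y • ψ1 y) hpk hhc.smul_right (ε / 2) hε2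
    obtain ⟨s, hs1, hs2⟩ := exists_between hs0
    set ψ2 : M → M := ψ1 + s • (fun y => h y • ψ1 y) with hψ2d
    have hψ2v : ∀ y, ψ2 y = (1 + s * h y) • ψ1 y := fun y => by
      simp [hψ2d, add_smul, mul_smul]
    have hpos : ∀ y, 0 < 1 + s * h y := fun y => by have := hh0 y; positivity
    have hψ2 : ψ2 ∈ CkEquivariant Γ M k := by
      refine ⟨hψ1.1.add (contDiff_const.smul hpk), ?_⟩
      intro γ y
      rw [hψ2v, hψ2v, hhi, hψ1.2, smul_comm γ]
    have hφ2 : ∀ y, φ (ψ2 y) = (1 + s * h y) • φ (ψ1 y) := fun y => by rw [hψ2v, map_smul]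
    have hfree2 : ∀ γ : Γ, γ ∉ T → γ • φ (ψ2 a) ≠ φ (ψ2 a) := by
      intro γ hγ he
      rw [hφ2, smul_comm] at he
      exact hfree γ hγ (smul_right_injective V (hpos a).ne' he)
    have hF2 : ∀ y, F (φ (ψ2 y)) = (1 + s * h y) ^ d * F (φ (ψ1 y)) := fun y => by
      rw [hφ2, hFs _ (hpos y).le]
    refine ⟨ψ2, ⟨hψ2, hfree2, ?_⟩, ?_⟩
    · intro γ hγ heq
      apply hγ
      have hT2 := hinst ψ2 hψ2 (hstab ψ2 hψ2 hfree2)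
      have hnorm : ∀ g : Γ, g ∈ T ↔ γ * g * γ⁻¹ ∈ T := by
        intro g
        rw [← hT2, aux_mem_inst, aux_mem_inst]
        constructor
        · intro hg w hw
          rw [← heq, Set.mem_smul_set_iff_inv_smul_mem] at hw
          rw [mul_smul, mul_smul, hg _ hw, smul_inv_smul]
        · intro hg w hw
          have := hg (γ • w) (by rw [← heq]; exact Set.smul_mem_smul_set hw)
          rw [mul_smul, mul_smul, inv_smul_smul] at this
          exact smul_left_cancel γ this
      have hmem : γ • φ (ψ2 x) ∈ φ '' (ψ2 '' A) := by
        rw [← heq]; exact Set.smul_mem_smul_set ⟨_, ⟨x, hx, rfl⟩, rfl⟩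
      obtain ⟨_, ⟨y, hy, rfl⟩, hyx⟩ := hmem
      have hFeq : F (φ (ψ2 y)) = F (φ (ψ2 x)) := by rw [hyx, hFi γ hnorm]
      have hd0 : d ≠ 0 := hd ⟨γ, fun h' => hγ (hTH γ h')⟩
      have hhy : h y = h x := by
        by_contra hne
        have hlt : h y < h x := lt_of_le_of_ne (hhx y) hne
        have h1 : (1 + s * h y) ^ d < (1 + s * h x) ^ d :=
          pow_lt_pow_left₀ (by gcongr) (hpos y).le hd0
        have h2 : (1 + s * h y) ^ d * F (φ (ψ1 y)) < (1 + s * h x) ^ d * F (φ (ψ1 x)) :=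
          calc _ ≤ (1 + s * h y) ^ d * F (φ (ψ1 x)) :=
                mul_le_mul_of_nonneg_left (hmax y hy) (pow_nonneg (hpos y).le _)
            _ < _ := mul_lt_mul_of_pos_right h1 hFx
        rw [← hF2, ← hF2] at h2
        exact h2.ne hFeq
      obtain ⟨δ, rfl⟩ := hho y hhy
      have hδA : δ • A = A := by
        rcases hdich δ with h' | h'
        · exact h'
        · have : δ • x ∈ (δ • A) ∩ A := ⟨Set.smul_mem_smul_set hx, hy⟩
          rw [h'] at this
          exact this.elim
      rw [hcomp ψ2 hψ2] at hyx
      have hw : (δ⁻¹ * γ) • φ (ψ2 x) = φ (ψ2 x) := by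
        rw [mul_smul, ← hyx, inv_smul_smul]
      have hmemT : δ⁻¹ * γ ∈ T := by
        by_contra hc
        refine (hFne (φ (ψ2 x))).1 ?_ _ hc hw
        rw [hF2]
        exact (mul_pos (pow_pos (hpos x) _) hFx).ne'
      have := hTH _ hmemT
      rw [mul_smul, inv_smul_eq_iff, hδA] at this
      exact this
    · calc ckDist k ψ2 ψ ≤ ckDist k ψ2 ψ1 + ckDist k ψ1 ψ :=
            aux_ck_tri k _ _ _ hψ2.1 hψ1.1 hψ.1
        _ < ε / 2 + ε / 2 := ENNReal.add_lt_add (hs s hs1 hs2 ψ1) hd1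
        _ = ε := ENNReal.add_halves ε
  · rintro ψ ⟨hψ, h1, h2⟩
    exact ⟨hstab ψ hψ h1, hinst ψ hψ (hstab ψ hψ h1), hstabA ψ hψ h2⟩
end

section
/- Let Γ be a finite group acting linearly on a finite-dimensional real vector space V. Suppose A ∈ 𝒜(V) (in particular, A satisfies the attractor dichotomy: γ·A = A or γ·A ∩ A = ∅ for every γ ∈ Γ), and suppose P ⊆ V is a Γ-invariant set (γ·P = P for all γ ∈ Γ) that meets A, i.e. A ∩ P ≠ ∅ (for an attractor this holds when a dense orbit in A intersects P). Then Σ(A ∩ P) = Σ(A): the invariant Poincaré section A ∩ P has the same average symmetry as A. -/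
open Pointwise

/-- **Invariant Poincaré section.**  If `A ∈ 𝒜(V)` (compact and satisfying the attractor
dichotomy), `P` is a `Γ`-invariant set meeting `A`, then the average symmetry of `A ∩ P`
equals that of `A`. -/
theorem invariant_poincare_section_symmetry {Γ V : Type*} [Group Γ] [Finite Γ]
    [NormedAddCommGroup V] [NormedSpace ℝ V] [FiniteDimensional ℝ V]
    [DistribMulAction Γ V] [SMulCommClass Γ ℝ V]
    (A P : Set V) (hcpt : IsCompact A)
    (hdich : ∀ γ : Γ, γ • A = A ∨ (γ • A) ∩ A = ∅)
    (hP : ∀ γ : Γ, γ • P = P) (hne : (A ∩ P).Nonempty) :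
    MulAction.stabilizer Γ (A ∩ P) = MulAction.stabilizer Γ A := by
  ext γ
  rw [MulAction.mem_stabilizer_iff, MulAction.mem_stabilizer_iff, Set.smul_set_inter, hP γ]
  constructor
  · intro h
    rcases hdich γ with h1 | h1
    · exact h1
    · obtain ⟨x, hx⟩ := hne
      have hx2 : x ∈ γ • A ∩ P := by rw [h]; exact hx
      have hx3 : x ∈ γ • A ∩ A := ⟨hx2.1, hx.1⟩
      rw [h1] at hx3
      exact hx3.elim
  · intro h
    rw [h]
end

section
/- For n ≥ 3 and integers q, r, the representations V_q and V_r of the dihedral group D_n on ℂ (with ρ·z = e^{2πiq/n} z, κ·z = z̄ on V_q, and ρ·z = e^{2πir/n} z, κ·z = z̄ on V_r) are isotropy equivalent if and only if gcd(q, n) = gcd(r, n). -/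
/-- The action of `DihedralGroup n` on `ℂ` for the representation `V_m`:
`ρ = r 1` acts by `z ↦ e^{2πim/n} z` and `κ = sr 0` acts by `z ↦ conj z`
(so `r i` acts by `z ↦ e^{2πim i/n} z` and `sr i = sr 0 * r i` acts by
`z ↦ e^{-2πim i/n} conj z`). -/
noncomputable def vmSMul (n : ℕ) (m : ℤ) : DihedralGroup n → ℂ → ℂ
  | DihedralGroup.r i, z =>
      Complex.exp (2 * (Real.pi : ℂ) * Complex.I * (m : ℂ) * (i.val : ℂ) / (n : ℂ)) * z
  | DihedralGroup.sr i, z =>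
      Complex.exp (-(2 * (Real.pi : ℂ) * Complex.I * (m : ℂ) * (i.val : ℂ) / (n : ℂ))) *
        (starRingEnd ℂ) z

lemma vm_r (n : ℕ) [NeZero n] (m : ℤ) (i : ZMod n) (z : ℂ) :
    vmSMul n m (DihedralGroup.r i) z = ZMod.stdAddChar ((m : ZMod n) * i) * z := by
  have h : (m : ZMod n) * i = ((m * (i.val : ℤ) : ℤ) : ZMod n) := by simp
  rw [h, ZMod.stdAddChar_coe]
  simp only [vmSMul]
  push_cast
  congr 2
  ring

lemma vm_sr (n : ℕ) [NeZero n] (m : ℤ) (i : ZMod n) (z : ℂ) :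
    vmSMul n m (DihedralGroup.sr i) z =
      ZMod.stdAddChar (-((m : ZMod n) * i)) * (starRingEnd ℂ) z := by
  have h : -((m : ZMod n) * i) = ((-(m * (i.val : ℤ)) : ℤ) : ZMod n) := by simp
  rw [h, ZMod.stdAddChar_coe]
  simp only [vmSMul]
  push_cast
  congr 2
  ring

lemma vm_r_fix (n : ℕ) [NeZero n] (m : ℤ) (i : ZMod n) (z : ℂ) (hz : z ≠ 0) :
    vmSMul n m (DihedralGroup.r i) z = z ↔ (m : ZMod n) * i = 0 := by
  rw [vm_r, mul_eq_right₀ hz, ← AddChar.map_zero_eq_one (ZMod.stdAddChar (N := n))]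
  exact (ZMod.injective_stdAddChar (N := n)).eq_iff

lemma vm_generic (n : ℕ) [NeZero n] : ∃ w : ℂ, w ≠ 0 ∧ ∀ (m : ℤ) (i : ZMod n),
    vmSMul n m (DihedralGroup.sr i) w ≠ w := by
  obtain ⟨w, hw⟩ := IsAlgClosed.exists_pow_nat_eq Complex.I (Nat.pos_of_ne_zero (NeZero.ne n))
  refine ⟨w, ?_, ?_⟩
  · rintro rfl
    rw [zero_pow (NeZero.ne n)] at hw
    exact Complex.I_ne_zero hw.symm
  · intro m i h
    rw [vm_sr] at h
    have h2 := congrArg (· ^ n) h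
    simp only [mul_pow, ← map_pow, hw, Complex.conj_I] at h2
    rw [← AddChar.map_nsmul_eq_pow] at h2
    simp at h2
    have := congrArg Complex.im h2
    norm_num at this

lemma vm_sr_fix (n : ℕ) [NeZero n] (m : ℤ) (i j : ZMod n) (z : ℂ) (hz : z ≠ 0)
    (hi : vmSMul n m (DihedralGroup.sr i) z = z) :
    vmSMul n m (DihedralGroup.sr j) z = z ↔ (m : ZMod n) * (j - i) = 0 := by
  have hc : (starRingEnd ℂ) z ≠ 0 := by simpa using hz
  rw [vm_sr] at *
  constructor
  · intro h
    have h3 := mul_right_cancel₀ hc (h.trans hi.symm)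
    have h4 := ZMod.injective_stdAddChar (N := n) h3
    rw [mul_sub, neg_injective h4, sub_self]
  · intro h
    rw [mul_sub, sub_eq_zero] at h
    rw [h, hi]

lemma vm_exists_sr (n : ℕ) [NeZero n] (m : ℤ) (i : ZMod n) : ∃ w : ℂ, w ≠ 0 ∧
    vmSMul n m (DihedralGroup.sr i) w = w := by
  obtain ⟨s, hs⟩ := IsAlgClosed.exists_pow_nat_eq
    (ZMod.stdAddChar (-((m : ZMod n) * i)) : ℂ) (n := 2) (by norm_num)
  have hn : ‖s‖ ^ 2 = 1 := by
    rw [← norm_pow, hs]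
    exact AddChar.norm_apply _ _
  have hss : s * (starRingEnd ℂ) s = 1 := by
    rw [Complex.mul_conj, Complex.normSq_eq_norm_sq, hn]; simp
  refine ⟨s, left_ne_zero_of_mul_eq_one hss, ?_⟩
  rw [vm_sr, ← hs, pow_two, mul_assoc, hss, mul_one]

lemma ker_gcd (n : ℕ) [NeZero n] (q : ℤ) (i : ZMod n) :
    (q : ZMod n) * i = 0 ↔ ((Int.gcd q n : ℕ) : ZMod n) * i = 0 := by
  have h : (q : ZMod n) * i = ((q * (i.val : ℤ) : ℤ) : ZMod n) := by simp
  have h' : ((Int.gcd q n : ℕ) : ZMod n) * i =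
    (((Int.gcd q n : ℤ) * (i.val : ℤ) : ℤ) : ZMod n) := by simp
  rw [h, h', ZMod.intCast_zmod_eq_zero_iff_dvd, ZMod.intCast_zmod_eq_zero_iff_dvd]
  constructor
  · intro hd
    rw [Int.gcd_eq_gcd_ab, add_mul]
    refine dvd_add ?_ ?_
    · rw [mul_right_comm]; exact hd.mul_right _
    · rw [mul_assoc]; exact dvd_mul_right _ _
  · intro hd
    exact hd.trans (mul_dvd_mul_right (Int.gcd_dvd_left ..) _)

lemma gcd_dvd_of_ker (n : ℕ) [NeZero n] (q r : ℤ)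
    (h : ∀ i : ZMod n, (q : ZMod n) * i = 0 → (r : ZMod n) * i = 0) :
    Int.gcd q n ∣ Int.gcd r n := by
  have hg : (Int.gcd q n : ℤ) ∣ n := Int.gcd_dvd_right ..
  obtain ⟨k, hk⟩ := hg
  obtain ⟨l, hl⟩ : (Int.gcd q n : ℤ) ∣ q := Int.gcd_dvd_left ..
  have hn0 : (n : ℤ) ≠ 0 := by exact_mod_cast NeZero.ne n
  have hk0 : k ≠ 0 := by
    rintro rfl
    exact hn0 (by simpa using hk)
  have h1 := h (k : ZMod n) (by
    rw [← Int.cast_mul, ZMod.intCast_zmod_eq_zero_iff_dvd]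
    refine ⟨l, ?_⟩
    conv_lhs => rw [hl]
    conv_rhs => rw [hk]
    ring)
  rw [← Int.cast_mul, ZMod.intCast_zmod_eq_zero_iff_dvd] at h1
  have h2 : (Int.gcd q n : ℤ) ∣ r := by
    have h3 : (Int.gcd q n : ℤ) * k ∣ r * k := by rw [← hk]; exact h1
    exact Int.dvd_of_mul_dvd_mul_right hk0 h3
  have h4 := Int.dvd_coe_gcd h2 (Dvd.intro _ hk.symm)
  exact_mod_cast h4

/-- The kernel rotations, as a subgroup. -/
def kerRot (n : ℕ) (q : ℤ) : Subgroup (DihedralGroup n) where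
  carrier := {g | ∃ i : ZMod n, g = DihedralGroup.r i ∧ (q : ZMod n) * i = 0}
  one_mem' := ⟨0, rfl, mul_zero _⟩
  mul_mem' := by
    rintro _ _ ⟨i, rfl, hi⟩ ⟨j, rfl, hj⟩
    exact ⟨i + j, by simp, by rw [mul_add, hi, hj, add_zero]⟩
  inv_mem' := by
    rintro _ ⟨i, rfl, hi⟩
    exact ⟨-i, by simp, by rw [mul_neg, hi, neg_zero]⟩

lemma ker_of_equiv (n : ℕ) [NeZero n] (q r : ℤ)
    (h : ∀ H : Subgroup (DihedralGroup n),
        (∃ z : ℂ, ∀ g : DihedralGroup n, g ∈ H ↔ vmSMul n q g z = z) →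
          (∃ z : ℂ, ∀ g : DihedralGroup n, g ∈ H ↔ vmSMul n r g z = z)) (i : ZMod n) :
    (q : ZMod n) * i = 0 → (r : ZMod n) * i = 0 := by
  intro hi
  obtain ⟨w, hw0, hw⟩ := vm_generic n
  obtain ⟨z, hz⟩ := h (kerRot n q) ⟨w, by
    rintro (j | j)
    · rw [vm_r_fix n q j w hw0]
      constructor
      · rintro ⟨k, hk, hk'⟩
        cases hk
        exact hk'
      · intro hj
        exact ⟨j, rfl, hj⟩
    · constructor
      · rintro ⟨k, hk, hk'⟩
        cases hk
      · intro hj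
        exact absurd hj (hw q j)⟩
  have hz0 : z ≠ 0 := by
    rintro rfl
    obtain ⟨k, hk, -⟩ := (hz (DihedralGroup.sr 0)).2 (by rw [vm_sr]; simp)
    cases hk
  exact (vm_r_fix n r i z hz0).1 ((hz _).1 ⟨i, rfl, hi⟩)

lemma equiv_of_ker (n : ℕ) [NeZero n] (q r : ℤ)
    (h : ∀ i : ZMod n, (q : ZMod n) * i = 0 ↔ (r : ZMod n) * i = 0)
    (H : Subgroup (DihedralGroup n))
    (hH : ∃ z : ℂ, ∀ g : DihedralGroup n, g ∈ H ↔ vmSMul n q g z = z) :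
    ∃ z : ℂ, ∀ g : DihedralGroup n, g ∈ H ↔ vmSMul n r g z = z := by
  obtain ⟨z, hz⟩ := hH
  by_cases hz0 : z = 0
  · subst hz0
    refine ⟨0, ?_⟩
    rintro (j | j)
    · rw [hz, vm_r, vm_r]; simp
    · rw [hz, vm_sr, vm_sr]; simp
  by_cases hs : ∃ i, vmSMul n q (DihedralGroup.sr i) z = z
  · obtain ⟨i, hi⟩ := hs
    obtain ⟨w, hw0, hw⟩ := vm_exists_sr n r i
    refine ⟨w, ?_⟩
    rintro (j | j)
    · rw [hz, vm_r_fix n q j z hz0, vm_r_fix n r j w hw0, h]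
    · rw [hz, vm_sr_fix n q i j z hz0 hi, vm_sr_fix n r i j w hw0 hw, h]
  · obtain ⟨w, hw0, hw⟩ := vm_generic n
    refine ⟨w, ?_⟩
    rintro (j | j)
    · rw [hz, vm_r_fix n q j z hz0, vm_r_fix n r j w hw0, h]
    · rw [hz]
      exact iff_of_false (fun hj => hs ⟨j, hj⟩) (hw r j)

/-- For `n ≥ 3`, the representations `V_q` and `V_r` of `D_n` on `ℂ` are isotropy
equivalent (they have exactly the same isotropy subgroups) if and only if
`gcd(q, n) = gcd(r, n)`. -/
theorem vq_vr_isotropy_equivalent_iff_gcd (n : ℕ) (hn : 3 ≤ n) (q r : ℤ) :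
    (∀ H : Subgroup (DihedralGroup n),
        (∃ z : ℂ, ∀ g : DihedralGroup n, g ∈ H ↔ vmSMul n q g z = z) ↔
          (∃ z : ℂ, ∀ g : DihedralGroup n, g ∈ H ↔ vmSMul n r g z = z)) ↔
      Int.gcd q (n : ℤ) = Int.gcd r (n : ℤ) := by
  haveI : NeZero n := ⟨by omega⟩
  constructor
  · intro h
    exact Nat.dvd_antisymm
      (gcd_dvd_of_ker n q r (ker_of_equiv n q r fun H => (h H).1))
      (gcd_dvd_of_ker n r q (ker_of_equiv n r q fun H => (h H).2))
  · intro h H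
    have hk : ∀ i : ZMod n, (q : ZMod n) * i = 0 ↔ (r : ZMod n) * i = 0 := by
      intro i
      rw [ker_gcd n q, ker_gcd n r, h]
    exact ⟨equiv_of_ker n q r hk H, equiv_of_ker n r q (fun i => (hk i).symm) H⟩
end

section
/- For n ≥ 3, the permutation representation of the dihedral group D_n on ℝ^{2n} = ℝⁿ ⊕ ℝⁿ — where D_n acts identically on each summand by ρ·(x₀, x₁, …, x_{n−1}) = (x₁, x₂, …, x₀) and κ·(x₀, x₁, …, x_{n−1}) = (x₀, x_{n−1}, x_{n−2}, …, x₁) — is isotropy equivalent to the direct sum ⊕_{m | n, m < n} V_m taken over all divisors m of n with m < n, where V_m is the representation of D_n on ℂ given by ρ·z = e^{2πim/n} z and κ·z = z̄. -/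
/-- The permutation action of `DihedralGroup n` on `ℝⁿ = (ZMod n → ℝ)`:
`ρ = r 1` acts by `(ρ·x)_j = x_{j+1}` and `κ = sr 0` acts by `(κ·x)_j = x_{-j}`. -/
def permSMul (n : ℕ) : DihedralGroup n → (ZMod n → ℝ) → ZMod n → ℝ
  | DihedralGroup.r i, x, j => x (j + i)
  | DihedralGroup.sr i, x, j => x (i - j)

open DihedralGroup

lemma aux_exp_one (k : ℕ) (hk : k ≠ 0) (t : ℤ) :
    Complex.exp (2 * (Real.pi : ℂ) * Complex.I * (t : ℂ) / (k : ℂ)) = 1 ↔ (k : ℤ) ∣ t := by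
  have hk' : (k : ℂ) ≠ 0 := by exact_mod_cast hk
  have h2 : (2 * (Real.pi : ℂ) * Complex.I) ≠ 0 := Complex.two_pi_I_ne_zero
  rw [Complex.exp_eq_one_iff]
  constructor
  · rintro ⟨s, hs⟩
    refine ⟨s, ?_⟩
    rw [div_eq_iff hk'] at hs
    have : (t : ℂ) = k * s := by
      apply mul_left_cancel₀ h2
      rw [hs]; ring
    exact_mod_cast this
  · rintro ⟨s, rfl⟩
    refine ⟨s, ?_⟩
    rw [div_eq_iff hk']
    push_cast; ring

lemma aux_perm {n : ℕ} (hn : 3 ≤ n) (H : Subgroup (DihedralGroup n)) :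
    (∃ p : (ZMod n → ℝ) × (ZMod n → ℝ),
          ∀ g : DihedralGroup n,
            g ∈ H ↔ (permSMul n g p.1 = p.1 ∧ permSMul n g p.2 = p.2)) ↔
      (r 2 ∈ H → sr 0 ∈ H) := by
  have : NeZero n := ⟨by omega⟩
  constructor
  · rintro ⟨⟨x, y⟩, hp⟩ h2
    have key : ∀ x : ZMod n → ℝ, permSMul n (r 2) x = x → permSMul n (sr 0) x = x := by
      intro x hx
      have h1 : ∀ j, x (j + 2) = x j := fun j => congrFun hx j
      have h3 : ∀ (s : ℕ) j, x (j + 2 * s) = x j := by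
        intro s
        induction s with
        | zero => intro j; simp
        | succ s ih =>
          intro j
          rw [← ih j, ← h1 (j + 2 * s)]
          congr 1; push_cast; ring
      funext j
      show x (0 - j) = x j
      rw [← h3 (-j).val j]
      congr 1
      rw [ZMod.natCast_zmod_val]; ring
    have h := (hp _).1 h2
    exact (hp _).2 ⟨key _ h.1, key _ h.2⟩
  · intro hG
    obtain ⟨e, he⟩ : ∃ e : Set (ZMod n) → ℝ, Function.Injective e := by
      have : Countable (Set (ZMod n)) := inferInstance
      obtain ⟨e, he⟩ := exists_injective_nat (Set (ZMod n))
      exact ⟨fun s => (e s : ℝ), Nat.cast_injective.comp he⟩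
    let F : ZMod n → Set (ZMod n) := fun j => {l | r (l - j) ∈ H ∨ sr (l + j) ∈ H}
    have hself : ∀ j, j ∈ F j := fun j => Or.inl (by
      rw [sub_self]; exact H.one_mem)
    have hrr : ∀ a b : ZMod n, r a ∈ H → r b ∈ H → r (a + b) ∈ H := fun a b ha hb => by
      have := H.mul_mem ha hb
      rwa [r_mul_r] at this
    have hrn : ∀ a : ZMod n, r a ∈ H → r (-a) ∈ H := fun a ha => H.inv_mem ha
    have hrs : ∀ a b : ZMod n, r a ∈ H → sr b ∈ H → sr (b - a) ∈ H := fun a b ha hb => by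
      have := H.mul_mem ha hb
      rwa [r_mul_sr] at this
    have hss : ∀ a b : ZMod n, sr a ∈ H → sr b ∈ H → r (b - a) ∈ H := fun a b ha hb => by
      have := H.mul_mem ha hb
      rwa [sr_mul_sr] at this
    have hsub : ∀ j l, l ∈ F j → F l ⊆ F j := by
      intro j l hl q hq
      rcases hl with hl | hl <;> rcases hq with hq | hq
      · left; convert hrr _ _ hl hq using 2; ring
      · right; convert hrs _ _ hl hq using 2; ring
      · right; convert hrs _ _ (hrn _ hq) hl using 2; ring
      · left; convert hss _ _ hl hq using 2; ring
    have hsymm : ∀ j l, l ∈ F j → j ∈ F l := by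
      intro j l hl
      rcases hl with hl | hl
      · left; convert hrn _ hl using 2; ring
      · right; rwa [add_comm]
    have hFeq : ∀ j l, e (F l) = e (F j) ↔ l ∈ F j := by
      intro j l
      rw [he.eq_iff]
      constructor
      · intro h; rw [← h]; exact hself l
      · intro h; exact Set.Subset.antisymm (hsub _ _ h) (hsub _ _ (hsymm _ _ h))
    have main : ∀ g : DihedralGroup n, g ∈ H ↔
        permSMul n g (fun j => e (F j)) = fun j => e (F j) := by
      rintro (a | i)
      · constructor
        · intro h; funext j
          refine (hFeq _ _).2 (Or.inl ?_)
          simpa using h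
        · intro h
          have h1 : ∀ j, j + a ∈ F j := fun j => (hFeq _ _).1 (congrFun h j)
          by_contra hc
          have h2 : ∀ j, sr (j + a + j) ∈ H := fun j => by
            rcases h1 j with h | h
            · exact absurd (by simpa using h) hc
            · exact h
          have h0 := h2 0
          have h3 : r 2 ∈ H := by
            convert hss _ _ h0 (h2 1) using 2; ring
          apply hc
          convert hss _ _ (hG h3) h0 using 2; ring
      · constructor
        · intro h; funext j
          refine (hFeq _ _).2 (Or.inr ?_)
          simpa using h
        · intro h
          have h1 : ∀ j, i - j ∈ F j := fun j => (hFeq _ _).1 (congrFun h j)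
          by_contra hc
          have h2 : ∀ j, r (i - j - j) ∈ H := fun j => by
            rcases h1 j with h | h
            · exact h
            · exact absurd (by simpa using h) hc
          have h0 := h2 0
          have h3 : r 2 ∈ H := by
            convert hrr _ _ h0 (hrn _ (h2 1)) using 2; ring
          apply hc
          convert hrs _ _ (hrn _ h0) (hG h3) using 2; ring
    exact ⟨⟨_, _⟩, fun g => ⟨fun h => ⟨(main g).1 h, (main g).1 h⟩, fun h => (main g).2 h.1⟩⟩

lemma aux_vm {n : ℕ} (hn : 3 ≤ n) (H : Subgroup (DihedralGroup n)) :
    (∃ f : {m : ℕ // m ∣ n ∧ m < n} → ℂ,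
          (∀ d : {m : ℕ // m ∣ n ∧ m < n}, 2 * (d : ℕ) = n → (f d).im = 0) ∧
          ∀ g : DihedralGroup n,
            g ∈ H ↔ ∀ d : {m : ℕ // m ∣ n ∧ m < n}, vmSMul n ((d : ℕ) : ℤ) g (f d) = f d) ↔
      (r 2 ∈ H → sr 0 ∈ H) := by
  have : NeZero n := ⟨by omega⟩
  have hn0 : n ≠ 0 := by omega
  constructor
  · rintro ⟨f, hf, hH⟩ h2
    rw [hH] at h2 ⊢
    intro d
    have hd := h2 d
    by_cases hz : f d = 0
    · rw [hz]; simp [vmSMul]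
    · have hv : (2 : ZMod n).val = 2 := by
        have := ZMod.val_cast_of_lt (n := n) (a := 2) (by omega)
        simpa using this
      simp only [vmSMul, hv] at hd
      have h1 := mul_right_cancel₀ hz (hd.trans (one_mul _).symm)
      have h3 := (aux_exp_one n hn0 ((d : ℕ) * 2)).1 (by
        rw [← h1]; congr 1; push_cast; ring)
      have h4 : n ∣ (d : ℕ) * 2 := by exact_mod_cast h3
      obtain ⟨c, hc⟩ := h4
      have hpos : 0 < (d : ℕ) := Nat.pos_of_dvd_of_pos d.2.1 (by omega)
      have hlt := d.2.2
      have hc1 : c = 1 := by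
        have : c < 2 := by
          by_contra hcc
          have : n * 2 ≤ n * c := Nat.mul_le_mul_left _ (by omega)
          omega
        rcases c with _ | _ | c
        · omega
        · rfl
        · omega
      subst hc1
      have him := hf d (by omega)
      simp [vmSMul, Complex.conj_eq_iff_im.2 him]
  · intro hG
    obtain ⟨k, hk⟩ : ∃ k : ℕ, ∀ t : ℤ, r (t : ZMod n) ∈ H ↔ (k : ℤ) ∣ t := by
      let A : AddSubgroup ℤ :=
        { carrier := {t | r (t : ZMod n) ∈ H}
          zero_mem' := by
            show r ((0 : ℤ) : ZMod n) ∈ H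
            rw [Int.cast_zero]; exact H.one_mem
          add_mem' := by
            intro a b ha hb
            show r ((a + b : ℤ) : ZMod n) ∈ H
            have := H.mul_mem ha hb
            rw [r_mul_r] at this
            rwa [Int.cast_add]
          neg_mem' := by
            intro a ha
            show r ((-a : ℤ) : ZMod n) ∈ H
            have := H.inv_mem ha
            rw [Int.cast_neg]; exact this }
      obtain ⟨a, ha⟩ := Int.subgroup_cyclic A
      refine ⟨a.natAbs, fun t => ?_⟩
      rw [Int.natAbs_dvd, ← Int.mem_zmultiples_iff, AddSubgroup.zmultiples_eq_closure, ← ha]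
      rfl
    have hkn : k ∣ n := by
      have := (hk n).1 (by
        rw [Int.cast_natCast, ZMod.natCast_self]; exact H.one_mem)
      exact_mod_cast this
    have hk0 : k ≠ 0 := by rintro rfl; exact hn0 (Nat.eq_zero_of_zero_dvd hkn)
    have hkc : (k : ℂ) ≠ 0 := by exact_mod_cast hk0
    have hkv : ∀ i : ZMod n, r i ∈ H ↔ (k : ℤ) ∣ (i.val : ℤ) := fun i => by
      rw [← hk]; simp
    by_cases hk1 : k = 1
    · subst hk1
      refine ⟨fun _ => 0, by simp, ?_⟩
      have hr : ∀ i : ZMod n, r i ∈ H := fun i => (hkv i).2 (by simp)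
      have h0 := hG (hr 2)
      rintro (i | i)
      · simp [vmSMul, hr]
      · simp only [vmSMul, map_zero, mul_zero, implies_true, iff_true]
        have := H.mul_mem h0 (hr i)
        simpa using this
    obtain ⟨d, rfl⟩ := hkn
    have hd0 : d ≠ 0 := by rintro rfl; simp at hn0
    have hdc : (d : ℂ) ≠ 0 := by exact_mod_cast hd0
    have hdlt : d < k * d := by
      have : 2 * d ≤ k * d := Nat.mul_le_mul_right _ (by omega)
      omega
    obtain ⟨z, hz, hz1, hzs⟩ : ∃ z : ℂ, z ≠ 0 ∧ (sr 0 ∈ H → z = 1) ∧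
        ∀ i : ZMod (k * d), sr i ∈ H ↔
          Complex.exp (-(2 * (Real.pi : ℂ) * Complex.I * (i.val : ℂ) / (k : ℂ))) *
            (starRingEnd ℂ) z = z := by
      have hex : (∃ i, sr i ∈ H) → ∃ i, sr i ∈ H ∧ (sr 0 ∈ H → i = 0) := by
        rintro ⟨i, hi⟩
        by_cases h0 : sr 0 ∈ H
        · exact ⟨0, h0, fun _ => rfl⟩
        · exact ⟨i, hi, fun h => absurd h h0⟩
      have hconj : ∀ x : ℝ, (starRingEnd ℂ) (Complex.exp (x * Complex.I)) =
          Complex.exp (-(x * Complex.I)) := by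
        intro x
        rw [← Complex.exp_conj]; simp
      have hstep : ∀ (x : ℝ) (w : ℂ), Complex.exp (-w) *
          (starRingEnd ℂ) (Complex.exp (x * Complex.I)) = Complex.exp (x * Complex.I) ↔
          Complex.exp (w + 2 * x * Complex.I) = 1 := by
        intro x w
        rw [hconj, ← Complex.exp_add, ← sub_eq_zero, ← sub_eq_zero (b := (1 : ℂ))]
        have e1 : Complex.exp (-w + -(x * Complex.I)) - Complex.exp (x * Complex.I) =
            -Complex.exp (-w + -(x * Complex.I)) *
              (Complex.exp (w + 2 * x * Complex.I) - 1) := by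
          rw [mul_sub, neg_mul, ← Complex.exp_add]
          have : -w + -(x * Complex.I) + (w + 2 * x * Complex.I) = x * Complex.I := by ring
          rw [this]; ring
        rw [e1, mul_eq_zero, neg_eq_zero]
        simp [Complex.exp_ne_zero]
      by_cases hS : ∃ i, sr i ∈ H
      · obtain ⟨i₀, hi₀, hi0⟩ := hex hS
        refine ⟨Complex.exp ((-(Real.pi * i₀.val / k) : ℝ) * Complex.I),
          Complex.exp_ne_zero _, ?_, ?_⟩
        · intro h; rw [hi0 h]; simp
        · intro i
          rw [hstep]
          have : 2 * (Real.pi : ℂ) * Complex.I * (i.val : ℂ) / (k : ℂ) +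
              2 * ((-(Real.pi * i₀.val / k) : ℝ) : ℂ) * Complex.I =
              2 * (Real.pi : ℂ) * Complex.I * (((i.val : ℤ) - (i₀.val : ℤ) : ℤ) : ℂ) / (k : ℂ) := by
            push_cast; ring
          rw [this, aux_exp_one k hk0, ← hk]
          have e2 : (((i.val : ℤ) - (i₀.val : ℤ) : ℤ) : ZMod (k * d)) = i - i₀ := by
            push_cast; simp
          rw [e2, ← sr_mul_sr, Subgroup.mul_mem_cancel_left _ hi₀]
      · refine ⟨Complex.exp ((Real.pi / (2 * k) : ℝ) * Complex.I),
          Complex.exp_ne_zero _, fun h => absurd ⟨_, h⟩ hS, ?_⟩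
        intro i
        refine ⟨fun h => absurd ⟨_, h⟩ hS, fun h => ?_⟩
        exfalso
        rw [hstep] at h
        have : 2 * (Real.pi : ℂ) * Complex.I * (i.val : ℂ) / (k : ℂ) +
              2 * ((Real.pi / (2 * k) : ℝ) : ℂ) * Complex.I =
              2 * (Real.pi : ℂ) * Complex.I * ((2 * (i.val : ℤ) + 1 : ℤ) : ℂ) /
                ((2 * k : ℕ) : ℂ) := by
          push_cast; field_simp
        rw [this, aux_exp_one (2 * k) (by omega)] at h
        obtain ⟨c, hc⟩ := h
        push_cast at hc
        rw [mul_assoc] at hc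
        omega
    have hfrac : ∀ i : ZMod (k * d),
        2 * (Real.pi : ℂ) * Complex.I * (((d : ℕ) : ℤ) : ℂ) * (i.val : ℂ) / ((k * d : ℕ) : ℂ) =
        2 * (Real.pi : ℂ) * Complex.I * (i.val : ℂ) / (k : ℂ) := by
      intro i; push_cast; field_simp
    refine ⟨fun m => if (m : ℕ) = d then z else 0, ?_, ?_⟩
    · intro m hm
      by_cases hmd : (m : ℕ) = d
      · have hk2 : k = 2 := by
          rw [hmd] at hm
          exact (Nat.eq_of_mul_eq_mul_right (by omega) hm).symm
        have h2 : r 2 ∈ H := by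
          have := (hk 2).2 (by rw [hk2]; simp)
          simpa using this
        simp [hmd, hz1 (hG h2)]
      · simp [hmd]
    · have hall : ∀ g : DihedralGroup (k * d),
          (∀ m : {m : ℕ // m ∣ k * d ∧ m < k * d},
            vmSMul (k * d) ((m : ℕ) : ℤ) g (if (m : ℕ) = d then z else 0) =
              if (m : ℕ) = d then z else 0) ↔ vmSMul (k * d) ((d : ℕ) : ℤ) g z = z := by
        intro g
        constructor
        · intro h
          simpa using h ⟨d, Dvd.intro_left k rfl, hdlt⟩
        · rintro h ⟨m, hm⟩
          by_cases hmd : m = d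
          · subst hmd; simpa using h
          · rcases g with i | i <;> simp [hmd, vmSMul]
      intro g
      rw [hall]
      rcases g with i | i
      · simp only [vmSMul]
        rw [hfrac, mul_eq_right₀ hz, hkv]
        exact_mod_cast (aux_exp_one k hk0 (i.val : ℤ)).symm
      · simp only [vmSMul]
        rw [hfrac, hzs]

/-- For `n ≥ 3`, the permutation representation of `D_n` on `ℝ^{2n} = ℝⁿ ⊕ ℝⁿ` is isotropy
equivalent to the direct sum `⊕_{m ∣ n, m < n} V_m`, where `V_m ⊆ ℂ` is cut down to the
real axis when it is really one-dimensional (i.e. when `2m = n`). -/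
theorem perm_rep_isotropy_equivalent_sum_of_divisor_reps (n : ℕ) (hn : 3 ≤ n) :
    ∀ H : Subgroup (DihedralGroup n),
      (∃ p : (ZMod n → ℝ) × (ZMod n → ℝ),
          ∀ g : DihedralGroup n,
            g ∈ H ↔ (permSMul n g p.1 = p.1 ∧ permSMul n g p.2 = p.2)) ↔
        (∃ f : {m : ℕ // m ∣ n ∧ m < n} → ℂ,
          (∀ d : {m : ℕ // m ∣ n ∧ m < n}, 2 * (d : ℕ) = n → (f d).im = 0) ∧
          ∀ g : DihedralGroup n,
            g ∈ H ↔ ∀ d : {m : ℕ // m ∣ n ∧ m < n}, vmSMul n ((d : ℕ) : ℤ) g (f d) = f d) := by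
  exact fun H => (aux_perm hn H).trans (aux_vm hn H).symm
end
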